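/- For A = ℤ[C₃], the integral group algebra of the cyclic group of order 3, the first homology of the partial complex vanishes: ker ∂₁ = im ∂₂; that is, HS₁(ℤ[C₃]) = 0. -/

import Mathlib

open TensorProduct

set_option synthInstance.maxHeartbeats 1000000
set_option maxHeartbeats 1000000

/-- The algebra `A = ℤ[C3]`, the integral group algebra of the cyclic group
of order 3. -/
abbrev A : Type := MonoidAlgebra ℤ (Multiplicative (ZMod 3))

/-- A function of three variables in `ZMod 3` killed by the defining relations of `HS₁(ℤ[C₃])`
is zero. -/
theorem eq_zero_of_HS1_relations {Q : Type*} [AddCommGroup Q]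
    (f : ZMod 3 → ZMod 3 → ZMod 3 → Q)
    (h : ∀ a b c d, f (a + b) c d + f d (c + a) b + f (b + c + a) 0 d + f d (b + c) a = 0)
    (u : ∀ a, f 0 a 0 = 0) (x y z : ZMod 3) : f x y z = 0 := by
  have left (c : ZMod 3) : f c 0 0 = 0 := by simpa [u] using h 0 0 c 0
  have right (b : ZMod 3) : f 0 0 b = 0 := by simpa [u, left] using h 0 b 0 0
  have r1120 : f 2 2 0 + f 0 0 1 + f 1 0 0 + f 0 0 1 = 0 := h 1 1 2 0
  have f220 : f 2 2 0 = 0 := by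
    linear_combination (norm := module) r1120 - right 1 - left 1 - right 1
  have r0220 : f 2 2 0 + f 0 2 2 + f 1 0 0 + f 0 1 0 = 0 := h 0 2 2 0
  have f022 : f 0 2 2 = 0 := by
    linear_combination (norm := module) r0220 - f220 - left 1 - u 1
  have r0022 : f 0 2 2 + f 2 2 0 + f 2 0 2 + f 2 2 0 = 0 := h 0 0 2 2
  have f202 : f 2 0 2 = 0 := by
    linear_combination (norm := module) r0022 - f022 - f220 - f220
  have r1222 : f 0 2 2 + f 2 0 2 + f 2 0 2 + f 2 1 1 = 0 := h 1 2 2 2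
  have f211 : f 2 1 1 = 0 := by
    linear_combination (norm := module) r1222 - f022 - f202 - f202
  have r0112 : f 1 1 2 + f 2 1 1 + f 2 0 2 + f 2 2 0 = 0 := h 0 1 1 2
  have f112 : f 1 1 2 = 0 := by
    linear_combination (norm := module) r0112 - f211 - f202 - f220
  have r1201 : f 0 0 1 + f 1 1 2 + f 0 0 1 + f 1 2 1 = 0 := h 1 2 0 1
  have f121 : f 1 2 1 = 0 := by
    linear_combination (norm := module) r1201 - right 1 - f112 - right 1
  have r1220 : f 0 2 0 + f 0 0 2 + f 2 0 0 + f 0 1 1 = 0 := h 1 2 2 0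
  have f011 : f 0 1 1 = 0 := by
    linear_combination (norm := module) r1220 - u 2 - right 2 - left 2
  have r0110 : f 1 1 0 + f 0 1 1 + f 2 0 0 + f 0 2 0 = 0 := h 0 1 1 0
  have f110 : f 1 1 0 = 0 := by
    linear_combination (norm := module) r0110 - f011 - left 2 - u 2
  have r0011 : f 0 1 1 + f 1 1 0 + f 1 0 1 + f 1 1 0 = 0 := h 0 0 1 1
  have f101 : f 1 0 1 = 0 := by
    linear_combination (norm := module) r0011 - f011 - f110 - f110
  have r1121 : f 2 2 1 + f 1 0 1 + f 1 0 1 + f 1 0 1 = 0 := h 1 1 2 1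
  have f221 : f 2 2 1 = 0 := by
    linear_combination (norm := module) r1121 - f101 - f101 - f101
  have r0122 : f 1 2 2 + f 2 2 1 + f 0 0 2 + f 2 0 0 = 0 := h 0 1 2 2
  have f122 : f 1 2 2 = 0 := by
    linear_combination (norm := module) r0122 - f221 - right 2 - left 2
  have r1112 : f 2 1 2 + f 2 2 1 + f 0 0 2 + f 2 2 1 = 0 := h 1 1 1 2
  have f212 : f 2 1 2 = 0 := by
    linear_combination (norm := module) r1112 - f221 - right 2 - f221
  have r0120 : f 1 2 0 + f 0 2 1 + f 0 0 0 + f 0 0 0 = 0 := h 0 1 2 0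
  have r0210 : f 2 1 0 + f 0 1 2 + f 0 0 0 + f 0 0 0 = 0 := h 0 2 1 0
  have r1200 : f 0 0 0 + f 0 1 2 + f 0 0 0 + f 0 2 1 = 0 := h 1 2 0 0
  have r1110 : f 2 1 0 + f 0 2 1 + f 0 0 0 + f 0 2 1 = 0 := h 1 1 1 0
  have r0012 : f 0 1 2 + f 2 1 0 + f 1 0 2 + f 2 1 0 = 0 := h 0 0 1 2
  have r0021 : f 0 2 1 + f 1 2 0 + f 2 0 1 + f 1 2 0 = 0 := h 0 0 2 1
  have r0111 : f 1 1 1 + f 1 1 1 + f 2 0 1 + f 1 2 0 = 0 := h 0 1 1 1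
  have r1101 : f 2 0 1 + f 1 1 1 + f 2 0 1 + f 1 1 1 = 0 := h 1 1 0 1
  have e021 : f 0 2 1 = -f 0 1 2 := by
    linear_combination (norm := module) r1200 - u 0 - u 0
  have e120 : f 1 2 0 = f 0 1 2 := by
    linear_combination (norm := module) r0120 - u 0 - u 0 - e021
  have e210 : f 2 1 0 = -f 0 1 2 := by
    linear_combination (norm := module) r0210 - u 0 - u 0
  have e102 : f 1 0 2 = f 0 1 2 := by
    linear_combination (norm := module) r0012 - (2 : ℤ) • e210
  have e201 : f 2 0 1 = -f 0 1 2 := by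
    linear_combination (norm := module) r0021 - e021 - (2 : ℤ) • e120
  have f012 : f 0 1 2 = 0 := by
    linear_combination (norm := module)
      r1101 - r0111 - e201 + e120 - r1110 + u 0 + e210 + (2 : ℤ) • e021
  have f021 : f 0 2 1 = 0 := by
    linear_combination (norm := module) e021 - f012
  have f120 : f 1 2 0 = 0 := by
    linear_combination (norm := module) e120 + f012
  have f210 : f 2 1 0 = 0 := by
    linear_combination (norm := module) e210 - f012
  have f102 : f 1 0 2 = 0 := by
    linear_combination (norm := module) e102 + f012
  have f201 : f 2 0 1 = 0 := by
    linear_combination (norm := module) e201 - f012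
  have r1221 : f 0 2 1 + f 1 0 2 + f 2 0 1 + f 1 1 1 = 0 := h 1 2 2 1
  have f111 : f 1 1 1 = 0 := by
    linear_combination (norm := module) r1221 - f021 - f102 - f201
  have r1122 : f 2 2 2 + f 2 0 1 + f 1 0 2 + f 2 0 1 = 0 := h 1 1 2 2
  have f222 : f 2 2 2 = 0 := by
    linear_combination (norm := module) r1122 - f201 - f102 - f201
  fin_cases x <;> fin_cases y <;> fin_cases z <;> first
    | exact u _
    | exact left _
    | exact right _
    | assumption

/-- HS₁(ℤ[C₃]) = 0: the first homology of the partial complex vanishes, i.e. `ker ∂₁ = im ∂₂`. -/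
theorem HS1_int_C3
    (d₁ : A ⊗[ℤ] (A ⊗[ℤ] A) →ₗ[ℤ] A)
    (d₂ : ((A ⊗[ℤ] (A ⊗[ℤ] (A ⊗[ℤ] A))) × A) →ₗ[ℤ] A ⊗[ℤ] (A ⊗[ℤ] A))
    (h₁ : ∀ a b c : A, d₁ (a ⊗ₜ[ℤ] (b ⊗ₜ[ℤ] c)) = a * b * c - c * b * a)
    (h₂ : ∀ a b c d : A, d₂ (a ⊗ₜ[ℤ] (b ⊗ₜ[ℤ] (c ⊗ₜ[ℤ] d)), 0) =
      (a * b) ⊗ₜ[ℤ] (c ⊗ₜ[ℤ] d) + d ⊗ₜ[ℤ] ((c * a) ⊗ₜ[ℤ] b) +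
        (b * c * a) ⊗ₜ[ℤ] ((1 : A) ⊗ₜ[ℤ] d) + d ⊗ₜ[ℤ] ((b * c) ⊗ₜ[ℤ] a))
    (h₃ : ∀ a : A, d₂ (0, a) = (1 : A) ⊗ₜ[ℤ] (a ⊗ₜ[ℤ] (1 : A))) :
    LinearMap.ker d₁ = LinearMap.range d₂ := by
  apply le_antisymm
  · suffices hr : LinearMap.range d₂ = ⊤ by simp [hr]
    have hB : ∀ x y z : ZMod 3,
        (LinearMap.range d₂).mkQ
          ((MonoidAlgebra.of ℤ _ (Multiplicative.ofAdd x) : A) ⊗ₜ[ℤ]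
            ((MonoidAlgebra.of ℤ _ (Multiplicative.ofAdd y) : A) ⊗ₜ[ℤ]
              (MonoidAlgebra.of ℤ _ (Multiplicative.ofAdd z) : A))) = 0 := by
      apply eq_zero_of_HS1_relations
      · intro a b c d
        simp only [← map_add, ofAdd_add, map_mul, ofAdd_zero, map_one]
        rw [← h₂]
        simp
      · intro a
        simp only [ofAdd_zero, map_one]
        rw [← h₃]
        simp
    rw [← Submodule.ker_mkQ (LinearMap.range d₂), LinearMap.ker_eq_top]
    ext x y z
    exact hB x.toAdd y.toAdd z.toAdd
  · rintro _ ⟨p, rfl⟩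
    have hd : d₁ = 0 := by
      ext x y z : 8
      refine (h₁ _ _ _).trans (sub_eq_zero.mpr ?_)
      ring
    simp [hd]
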